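/- For every k ∈ ℤ with k ≠ 0 and every n ∈ ℕ, the following identity holds in End(ℂ[z,z⁻¹]): ((ad D²) − k²)^n (z^k·1) = (2k)^n · z^k D^n, where (ad D²)(X) = D²∘X − X∘D² and ((ad D²) − k²)^n denotes the n-th iterate of the map X ↦ (ad D²)(X) − k²·X. Equivalently, z^k D^n = (2k)^{−n}·((ad D²) − k²)^n (z^k·1). -/

import Mathlib

/-- The operator `z^k f(D)` on `ℂ[z,z⁻¹]` (Laurent polynomials realized as finitely
supported functions `ℤ → ℂ` on the basis `z^n ↔ single n 1`): it sends `z^n` to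
`f(n)·z^{n+k}`.  In particular `z^k·1 = opE k 1`, `D = opE 0 X`,
`D² = opE 0 X²` and `z^k Dⁿ = opE k Xⁿ`. -/
noncomputable def opE (k : ℤ) (f : Polynomial ℂ) : Module.End ℂ (ℤ →₀ ℂ) :=
  Finsupp.lsum ℂ fun n => Polynomial.eval ((n : ℤ) : ℂ) f • Finsupp.lsingle (n + k)

@[simp]
theorem opE_single (k : ℤ) (f : Polynomial ℂ) (m : ℤ) (c : ℂ) :
    opE k f (Finsupp.single m c) = Finsupp.single (m + k) (f.eval (m : ℂ) * c) := by
  simp [opE]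

theorem ad_D_squared_sub_opE (k : ℤ) (f : Polynomial ℂ) :
    opE 0 (Polynomial.X ^ 2) * opE k f - opE k f * opE 0 (Polynomial.X ^ 2)
      - ((k : ℂ) ^ 2) • opE k f = (2 * (k : ℂ)) • opE k (f * Polynomial.X) := by
  refine Finsupp.lhom_ext fun m c => ?_
  simp only [LinearMap.sub_apply, LinearMap.smul_apply, Module.End.mul_apply, opE_single,
    Finsupp.smul_single, add_zero, ← Finsupp.single_sub, Polynomial.eval_pow,
    Polynomial.eval_X, Polynomial.eval_mul, smul_eq_mul]
  congr 1
  push_cast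
  ring

theorem ad_D_squared_sub_iterate (k : ℤ) (n : ℕ) :
    (fun T : Module.End ℂ (ℤ →₀ ℂ) =>
        opE 0 (Polynomial.X ^ 2) * T - T * opE 0 (Polynomial.X ^ 2)
          - ((k : ℂ) ^ 2) • T)^[n] (opE k 1)
      = ((2 * (k : ℂ)) ^ n) • opE k (Polynomial.X ^ n) := by
  induction n with
  | zero => simp
  | succ n ih =>
    rw [Function.iterate_succ_apply', ih, pow_succ (2 * (k : ℂ)), mul_smul,
      pow_succ Polynomial.X n, ← ad_D_squared_sub_opE,
      mul_smul_comm, smul_mul_assoc]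
    module

/-- For `k ≠ 0` and `n ∈ ℕ`:
`((ad D²) − k²)^n (z^k·1) = (2k)^n · z^k D^n` in `End(ℂ[z,z⁻¹])`; equivalently
`z^k D^n = (2k)^{−n}·((ad D²) − k²)^n (z^k·1)`. -/
theorem ad_D_squared_iterate_formula (k : ℤ) (hk : k ≠ 0) (n : ℕ) :
    ((fun T : Module.End ℂ (ℤ →₀ ℂ) =>
        opE 0 (Polynomial.X ^ 2) * T - T * opE 0 (Polynomial.X ^ 2)
          - ((k : ℂ) ^ 2) • T)^[n] (opE k 1)
      = ((2 * (k : ℂ)) ^ n) • opE k (Polynomial.X ^ n)) ∧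
    (opE k (Polynomial.X ^ n)
      = (((2 * (k : ℂ))⁻¹) ^ n) •
          (fun T : Module.End ℂ (ℤ →₀ ℂ) =>
            opE 0 (Polynomial.X ^ 2) * T - T * opE 0 (Polynomial.X ^ 2)
              - ((k : ℂ) ^ 2) • T)^[n] (opE k 1)) := by
  refine ⟨ad_D_squared_sub_iterate k n, ?_⟩
  have hk' : (2 * (k : ℂ)) ≠ 0 := mul_ne_zero two_ne_zero (Int.cast_ne_zero.mpr hk)
  rw [ad_D_squared_sub_iterate, smul_smul, ← mul_pow, inv_mul_cancel₀ hk', one_pow, one_smul]
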